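/- For the k-user MISO broadcast channel with hybrid CSIT, if the number of receivers supplying instantaneous CSIT is at least the number supplying delayed CSIT (|𝒫| ≥ |𝒟|) and |𝒫| ≥ 1, then |𝒫| ≤ LDoF_sum ≤ |𝒫| + |𝒫|/2^{|𝒫|} ≤ |𝒫| + 1/2. -/

import Mathlib

open MeasureTheory Matrix Filter Topology

noncomputable section

/-- CSIT state of a receiver: instantaneous (`P`), delayed (`D`), or none (`N`). -/
inductive CSITState : Type
  | P : CSITState
  | D : CSITState
  | N : CSITState
  deriving DecidableEq

/-- A channel realization: for each receiver `j`, time slot `t` and transmit antenna `a`,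
the channel coefficient `g j t a`. -/
abbrev Chan (k m n : ℕ) : Type := Fin k → Fin n → Fin m → ℂ

/-- Joint law of the channel coefficients: all entries i.i.d. with common law `μ`. -/
def chanMeasure (k m n : ℕ) (μ : Measure ℂ) : Measure (Chan k m n) :=
  Measure.pi fun _ : Fin k => Measure.pi fun _ : Fin n => Measure.pi fun _ : Fin m => μ

/-- The block-diagonal channel matrix `G_j^n ∈ ℂ^{n × nm}` of a receiver with
channel vectors `g (t) ∈ ℂ^{1 × m}`. -/
def blockDiag {m n : ℕ} (g : Fin n → Fin m → ℂ) : Matrix (Fin n) (Fin n × Fin m) ℂ :=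
  Matrix.of fun t p => if p.1 = t then g t p.2 else 0

/-- A linear coding strategy of block length `n` for the `k`-user MISO BC with `m`
transmit antennas and hybrid CSIT configuration `I`. -/
structure Strategy (k m n : ℕ) (I : Fin k → CSITState) : Type where
  /-- number of information symbols `m_j(n)` for receiver `j` -/
  dim : Fin k → ℕ
  /-- precoding matrix `V_j(t) ∈ ℂ^{m × m_j(n)}`, a function of the channel realization -/
  pre : (j : Fin k) → Fin n → Chan k m n → Matrix (Fin m) (Fin (dim j)) ℂ
  /-- each precoder is a measurable function of the channels -/
  meas : ∀ j t a c, Measurable fun g => pre j t g a c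
  /-- `V_j(t)` depends only on the CSIT available at time `t`: current and past channels of
  receivers with instantaneous CSIT, and strictly past channels of receivers with delayed
  CSIT (and nothing from receivers with no CSIT). -/
  causal : ∀ (j : Fin k) (t : Fin n) (g g' : Chan k m n),
    (∀ i, I i = CSITState.P → ∀ s : Fin n, (s : ℕ) ≤ (t : ℕ) → g i s = g' i s) →
    (∀ i, I i = CSITState.D → ∀ s : Fin n, (s : ℕ) < (t : ℕ) → g i s = g' i s) →
    pre j t g = pre j t g'

namespace Strategy

variable {k m n : ℕ} {I : Fin k → CSITState}

/-- The overall precoding matrix `V_j^n ∈ ℂ^{nm × m_j(n)}` (vertical concatenation of the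
`V_j(t)`). -/
def Vn (f : Strategy k m n I) (j : Fin k) (g : Chan k m n) :
    Matrix (Fin n × Fin m) (Fin (f.dim j)) ℂ :=
  Matrix.of fun r c => f.pre j r.1 g r.2 c

/-- Horizontal concatenation `[∪_{i ∈ S} V_i^n]` of the precoding matrices of the
receivers in `S`. -/
def VS (f : Strategy k m n I) (S : Finset (Fin k)) (g : Chan k m n) :
    Matrix (Fin n × Fin m) ((i : {x // x ∈ S}) × Fin (f.dim i.1)) ℂ :=
  Matrix.of fun r c => f.Vn c.1.1 g r c.2

/-- The received-signal matrix `G_j^n [∪_{i ∈ S} V_i^n]` at receiver `j`. -/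
def recvS (f : Strategy k m n I) (S : Finset (Fin k)) (j : Fin k) (g : Chan k m n) :
    Matrix (Fin n) ((i : {x // x ∈ S}) × Fin (f.dim i.1)) ℂ :=
  blockDiag (g j) * f.VS S g

/-- The received-signal matrix `G_j^n V_j^n` at receiver `j` from its own precoder. -/
def recv1 (f : Strategy k m n I) (j : Fin k) (g : Chan k m n) :
    Matrix (Fin n) (Fin (f.dim j)) ℂ :=
  blockDiag (g j) * f.Vn j g

/-- `G_j^t [∪_{i ∈ S} V_i^t]`: the received signal matrix restricted to the first `t`
time slots (rows beyond `t` set to zero, so that its rank is that of the truncated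
matrix, with the `t = 0` convention of rank `0`). -/
def recvUpTo (f : Strategy k m n I) (S : Finset (Fin k)) (j : Fin k)
    (g : Chan k m n) (t : ℕ) :
    Matrix (Fin n) ((i : {x // x ∈ S}) × Fin (f.dim i.1)) ℂ :=
  Matrix.of fun s c => if (s : ℕ) < t then f.recvS S j g s c else 0

/-- Decodability: for every receiver `j`, almost surely
`rank[G_j^n[∪_i V_i^n]] − rank[G_j^n[∪_{i ≠ j} V_i^n]] = rank[G_j^n V_j^n] = m_j(n)`. -/
def Decodable (f : Strategy k m n I) (μ : Measure ℂ) : Prop :=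
  ∀ j : Fin k, ∀ᵐ g ∂ chanMeasure k m n μ,
    (f.recvS Finset.univ j g).rank - (f.recvS (Finset.univ.erase j) j g).rank
        = (f.recv1 j g).rank ∧
    (f.recv1 j g).rank = f.dim j

end Strategy

/-- A DoF tuple is linearly achievable if there is a sequence of decodable strategies
achieving it in the limit. -/
def LinAchievable (k m : ℕ) (I : Fin k → CSITState) (μ : Measure ℂ) (d : Fin k → ℝ) : Prop :=
  (∀ j, 0 ≤ d j ∧ d j ≤ 1) ∧
  ∃ F : (n : ℕ) → Strategy k m n I,
    (∀ n, (F n).Decodable μ) ∧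
    ∀ j, Tendsto (fun n : ℕ => ((F n).dim j : ℝ) / n) atTop (nhds (d j))

/-- The linear degrees-of-freedom region: closure of the set of linearly achievable tuples. -/
def LDoFRegion (k m : ℕ) (I : Fin k → CSITState) (μ : Measure ℂ) : Set (Fin k → ℝ) :=
  closure {d | LinAchievable k m I μ d}

/-- The linear sum degrees of freedom. -/
def LDoFSum (k m : ℕ) (I : Fin k → CSITState) (μ : Measure ℂ) : ℝ :=
  sSup ((fun d => ∑ j, d j) '' LDoFRegion k m I μ)

/-- The set `𝒫` of receivers supplying instantaneous CSIT. -/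
def stateP (k : ℕ) (I : Fin k → CSITState) : Finset (Fin k) :=
  Finset.univ.filter fun i => I i = CSITState.P

/-- The set `𝒟` of receivers supplying delayed CSIT. -/
def stateD (k : ℕ) (I : Fin k → CSITState) : Finset (Fin k) :=
  Finset.univ.filter fun i => I i = CSITState.D

/-- The set `𝒩` of receivers supplying no CSIT. -/
def stateN (k : ℕ) (I : Fin k → CSITState) : Finset (Fin k) :=
  Finset.univ.filter fun i => I i = CSITState.N


/-! ### Almost sure statements on product spaces -/

/-- A measurable property holding for almost every value of one coordinate, whatever the other
coordinates are, holds almost surely. -/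
theorem ae_pi_of_forall_ae_update {ι : Type*} [Fintype ι] [DecidableEq ι] {X : ι → Type*}
    [∀ i, MeasurableSpace (X i)] (μ : ∀ i, Measure (X i)) [∀ i, SigmaFinite (μ i)] (i : ι)
    {p : (∀ i, X i) → Prop} (hp : MeasurableSet {x | p x})
    (h : ∀ x, ∀ᵐ y ∂ μ i, p (Function.update x i y)) : ∀ᵐ x ∂ Measure.pi μ, p x := by
  rcases isEmpty_or_nonempty (∀ i, X i) with hE | ⟨⟨x₀⟩⟩
  · exact Eventually.of_forall fun x => (hE.false x).elim
  rw [ae_iff]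
  have hm : MeasurableSet {x | ¬ p x} := hp.compl
  have hf : Measurable ({x | ¬ p x}.indicator (1 : (∀ i, X i) → ENNReal)) :=
    measurable_one.indicator hm
  rw [← lintegral_indicator_one hm, lintegral_eq_lmarginal_univ x₀,
    ← Finset.insert_erase (Finset.mem_univ i),
    lmarginal_insert' _ hf (Finset.notMem_erase i _)]
  have h0 : (fun x => ∫⁻ y, {x | ¬ p x}.indicator (1 : (∀ i, X i) → ENNReal)
      (Function.update x i y) ∂ μ i) = fun _ => 0 := by
    funext x
    refine (lintegral_congr_ae ?_).trans lintegral_zero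
    filter_upwards [h x] with y hy
    simp [hy]
  rw [h0]
  simp [lmarginal]

/-- A generic linear combination of vectors that are not all in a subspace avoids that
subspace. -/
theorem ae_pi_sum_smul_mem_imp {ι E : Type*} [Fintype ι] [NormedAddCommGroup E]
    [NormedSpace ℂ E] [FiniteDimensional ℂ E] (μ : Measure ℂ) [SigmaFinite μ]
    [NullSingletonClass μ]
    (v : ι → E) (B : Submodule ℂ E) :
    ∀ᵐ z ∂ Measure.pi (fun _ : ι => μ), (∑ a, z a • v a) ∈ B → ∀ a, v a ∈ B := by
  classical
  by_cases hv : ∀ a, v a ∈ B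
  · exact Eventually.of_forall fun _ _ => hv
  obtain ⟨a, ha⟩ := not_forall.1 hv
  have key : ∀ᵐ z ∂ Measure.pi (fun _ : ι => μ), (∑ a, z a • v a) ∉ B := by
    refine ae_pi_of_forall_ae_update _ a ?_ fun z => ?_
    · have hc : Continuous fun z : ι → ℂ => ∑ a, z a • v a := by fun_prop
      exact ((B.closed_of_finiteDimensional.preimage hc).measurableSet).compl
    · rw [ae_iff]
      refine Set.Subsingleton.measure_zero (fun y hy y' hy' => ?_) μ
      simp only [not_not, Set.mem_ofPred_eq] at hy hy'
      have hsum : ∀ y : ℂ, (∑ b, Function.update z a y b • v b)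
          = y • v a + ∑ b ∈ Finset.univ.erase a, z b • v b := fun y => by
        rw [← Finset.add_sum_erase _ _ (Finset.mem_univ a), Function.update_self]
        congr 1
        refine Finset.sum_congr rfl fun b hb => ?_
        rw [Function.update_of_ne (Finset.ne_of_mem_erase hb)]
      rw [hsum] at hy hy'
      have hd := B.sub_mem hy hy'
      rw [add_sub_add_right_eq_sub, ← sub_smul] at hd
      by_contra hne
      exact ha ((B.smul_mem_iff (sub_ne_zero.2 hne)).1 hd)
  filter_upwards [key] with z hz h
  exact (hz h).elim

/-! ### Measurability of the rank -/

theorem le_finrank_span_range_iff {ι E : Type*} [Finite ι] [AddCommGroup E] [Module ℂ E]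
    (v : ι → E) (r : ℕ) :
    r ≤ Module.finrank ℂ (Submodule.span ℂ (Set.range v)) ↔
      ∃ e : Fin r → ι, LinearIndependent ℂ (v ∘ e) := by
  have := Module.Finite.span_of_finite ℂ (Set.finite_range v)
  constructor
  · intro h
    obtain ⟨κ, a, ha, hs, hl⟩ := exists_linearIndependent' ℂ v
    have : Finite κ := Finite.of_injective a ha
    have := Fintype.ofFinite κ
    rw [← hs, finrank_span_eq_card hl] at h
    let φ : Fin r → κ := fun i => (Fintype.equivFin κ).symm (Fin.castLE h i)
    exact ⟨a ∘ φ, hl.comp φ ((Fintype.equivFin κ).symm.injective.comp (Fin.castLE_injective h))⟩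
  · rintro ⟨e, he⟩
    have h1 := finrank_span_eq_card he
    rw [Fintype.card_fin] at h1
    rw [← h1]
    exact Submodule.finrank_mono (Submodule.span_mono (Set.range_comp_subset_range e v))

theorem measurable_finrank_span_range {Ω ι C : Type*} [MeasurableSpace Ω] [Finite ι]
    [Fintype C] {M : Ω → ι → C → ℂ} (hM : ∀ i c, Measurable fun ω => M ω i c) :
    Measurable fun ω => Module.finrank ℂ (Submodule.span ℂ (Set.range (M ω))) := by
  refine measurable_of_Ici fun r => ?_
  have : (fun ω => Module.finrank ℂ (Submodule.span ℂ (Set.range (M ω)))) ⁻¹' Set.Ici r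
      = ⋃ e : Fin r → ι, (fun ω => M ω ∘ e) ⁻¹' {f | LinearIndependent ℂ f} := by
    ext ω
    simp [le_finrank_span_range_iff]
  rw [this]
  refine MeasurableSet.iUnion fun e => ?_
  refine isOpen_setOfPred_linearIndependent.measurableSet.preimage ?_
  exact measurable_pi_iff.2 fun i => measurable_pi_iff.2 fun c => hM _ _

theorem measurableSet_mem_span_range {Ω ι C : Type*} [MeasurableSpace Ω] [Finite ι]
    [Fintype C] {M : Ω → ι → C → ℂ} (hM : ∀ i c, Measurable fun ω => M ω i c)
    {w : Ω → C → ℂ} (hw : ∀ c, Measurable fun ω => w ω c) :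
    MeasurableSet {ω | w ω ∈ Submodule.span ℂ (Set.range (M ω))} := by
  let M' : Ω → Option ι → C → ℂ := fun ω o => o.elim (w ω) (M ω)
  have hM' : ∀ o c, Measurable fun ω => M' ω o c := by
    rintro (_ | i) c
    exacts [hw c, hM i c]
  have hr : ∀ ω, Set.range (M' ω) = insert (w ω) (Set.range (M ω)) := fun ω => by
    ext x
    simp [M', Option.exists, eq_comm]
  have hset : {ω | w ω ∈ Submodule.span ℂ (Set.range (M ω))} =
      {ω | Module.finrank ℂ (Submodule.span ℂ (Set.range (M' ω)))
        = Module.finrank ℂ (Submodule.span ℂ (Set.range (M ω)))} := by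
    ext ω
    simp only [Set.mem_ofPred_eq]
    have hle : Submodule.span ℂ (Set.range (M ω)) ≤ Submodule.span ℂ (Set.range (M' ω)) :=
      Submodule.span_mono (by rw [hr]; exact Set.subset_insert _ _)
    constructor
    · intro h
      rw [hr, Submodule.span_insert_eq_span h]
    · intro h
      rw [Submodule.eq_of_le_of_finrank_eq hle h.symm, hr]
      exact Submodule.subset_span (Set.mem_insert _ _)
  rw [hset]
  exact measurableSet_eq_fun (measurable_finrank_span_range hM')
    (measurable_finrank_span_range hM)

/-! ### Genericity of a channel vector -/

/-- If the vectors `v a` and the family `M` do not depend on the channel vector of receiver `j`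
at time `t`, then almost surely the signal received by `j` at time `t` is in the span of `M`
only if every `v a` is. -/
theorem ae_chan_mem_span_imp {k m n : ℕ} (μ : Measure ℂ) [IsProbabilityMeasure μ]
    [NullSingletonClass μ]
    {ι C : Type*} [Finite ι] [Fintype C] (j : Fin k) (t : Fin n)
    {M : Chan k m n → ι → C → ℂ} (hM : ∀ i c, Measurable fun g => M g i c)
    {v : Chan k m n → Fin m → C → ℂ} (hv : ∀ a c, Measurable fun g => v g a c)
    (hMj : ∀ g z, M (Function.update g j (Function.update (g j) t z)) = M g)
    (hvj : ∀ g z, v (Function.update g j (Function.update (g j) t z)) = v g) :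
    ∀ᵐ g ∂ chanMeasure k m n μ,
      (∑ a, g j t a • v g a) ∈ Submodule.span ℂ (Set.range (M g)) →
        ∀ a, v g a ∈ Submodule.span ℂ (Set.range (M g)) := by
  have hmeas : MeasurableSet {g : Chan k m n |
      (∑ a, g j t a • v g a) ∈ Submodule.span ℂ (Set.range (M g)) →
        ∀ a, v g a ∈ Submodule.span ℂ (Set.range (M g))} := by
    refine MeasurableSet.imp (measurableSet_mem_span_range hM fun c => ?_) ?_
    · simp only [Finset.sum_apply, Pi.smul_apply, smul_eq_mul]
      refine Finset.measurable_sum _ fun a _ => Measurable.mul ?_ (hv a c)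
      fun_prop
    · rw [Set.ofPred_forall]
      exact MeasurableSet.iInter fun a => measurableSet_mem_span_range hM (hv a)
  refine ae_pi_of_forall_ae_update _ j hmeas fun g => ?_
  refine ae_pi_of_forall_ae_update _ t
    (hmeas.preimage (measurable_update g)) fun y => ?_
  filter_upwards [ae_pi_sum_smul_mem_imp μ (v (Function.update g j y))
    (Submodule.span ℂ (Set.range (M (Function.update g j y))))] with z hz
  have e : Function.update g j (Function.update y t z) =
      Function.update (Function.update g j y) j
        (Function.update (Function.update g j y j) t z) := by
    simp
  rw [e, hMj, hvj]
  simpa using hz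

/-! ### Dimension counts -/

theorem finrank_span_singleton_le_one {E : Type*} [AddCommGroup E] [Module ℂ E] (x : E) :
    Module.finrank ℂ (Submodule.span ℂ {x}) ≤ 1 := by
  rcases eq_or_ne x 0 with rfl | hx
  · rw [Submodule.span_zero_singleton, finrank_bot]
    exact zero_le_one
  · exact (finrank_span_singleton hx).le

theorem finrank_sup_span_singleton_le {E : Type*} [AddCommGroup E] [Module ℂ E]
    [FiniteDimensional ℂ E] (C : Submodule ℂ E) (x : E) :
    Module.finrank ℂ ↥(C ⊔ Submodule.span ℂ {x}) ≤ Module.finrank ℂ C + 1 :=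
  (Submodule.finrank_add_le_finrank_add_finrank _ _).trans
    (Nat.add_le_add_left (finrank_span_singleton_le_one x) _)

theorem finrank_lt_finrank_sup_span_singleton {E : Type*} [AddCommGroup E] [Module ℂ E]
    [FiniteDimensional ℂ E] {C : Submodule ℂ E} {x : E} (hx : x ∉ C) :
    Module.finrank ℂ C < Module.finrank ℂ ↥(C ⊔ Submodule.span ℂ {x}) := by
  refine Submodule.finrank_lt_finrank_of_lt (lt_of_le_of_ne le_sup_left fun h => hx ?_)
  rw [h]
  exact Submodule.mem_sup_right (Submodule.mem_span_singleton_self x)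

theorem finrank_map_add_finrank_inf_ker {E F : Type*} [AddCommGroup E] [Module ℂ E]
    [FiniteDimensional ℂ E] [AddCommGroup F] [Module ℂ F] (φ : E →ₗ[ℂ] F) (R : Submodule ℂ E) :
    Module.finrank ℂ (R.map φ) + Module.finrank ℂ ↥(R ⊓ LinearMap.ker φ)
      = Module.finrank ℂ R := by
  have h := LinearMap.finrank_range_add_finrank_ker (φ.domRestrict R)
  rwa [LinearMap.range_domRestrict, LinearMap.ker_domRestrict,
    ← Submodule.finrank_map_subtype_eq R, Submodule.map_comap_subtype] at h

theorem image_setOf_lt_succ {n : ℕ} {E : Type*} (r : Fin n → E) (t : Fin n) :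
    r '' {s | (s : ℕ) < t + 1} = insert (r t) (r '' {s | s < t}) := by
  rw [← Set.image_insert_eq]
  congr 1
  ext s
  simp only [Set.mem_ofPred_eq, Set.mem_insert_iff, Fin.ext_iff, Fin.lt_def]
  omega

/-- If `r' t` is in the span of the past of `r` whenever `r t` is, then the joint span of `r` and
`r'` is at most twice as large as the span of `r`. -/
theorem finrank_span_sup_le_two_mul {n : ℕ} {E : Type*} [AddCommGroup E] [Module ℂ E]
    [FiniteDimensional ℂ E] (r r' : Fin n → E)
    (h : ∀ t, r t ∈ Submodule.span ℂ (r '' {s | s < t}) →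
      r' t ∈ Submodule.span ℂ (r '' {s | s < t})) :
    Module.finrank ℂ ↥(Submodule.span ℂ (Set.range r) ⊔ Submodule.span ℂ (Set.range r'))
      ≤ 2 * Module.finrank ℂ (Submodule.span ℂ (Set.range r)) := by
  have key : ∀ T : ℕ, T ≤ n →
      Module.finrank ℂ ↥(Submodule.span ℂ (r '' {s | (s : ℕ) < T}) ⊔
          Submodule.span ℂ (r' '' {s | (s : ℕ) < T}))
        ≤ 2 * Module.finrank ℂ (Submodule.span ℂ (r '' {s | (s : ℕ) < T})) := by
    intro T
    induction T with
    | zero =>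
      intro _
      have h0 : {s : Fin n | (s : ℕ) < 0} = ∅ := by ext s; simp
      rw [h0, Set.image_empty, Set.image_empty, Submodule.span_empty, sup_bot_eq, finrank_bot]
    | succ T ih =>
      intro hT
      have ih := ih (Nat.le_of_succ_le hT)
      have ht := h ⟨T, hT⟩
      have e := image_setOf_lt_succ r ⟨T, hT⟩
      have e' := image_setOf_lt_succ r' ⟨T, hT⟩
      simp only [Fin.lt_def] at e e' ht
      rw [e, e', Submodule.span_insert, Submodule.span_insert]
      set x := r ⟨T, hT⟩
      set x' := r' ⟨T, hT⟩
      set A := Submodule.span ℂ (r '' {s | (s : ℕ) < T})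
      set A' := Submodule.span ℂ (r' '' {s | (s : ℕ) < T})
      by_cases hx : x ∈ A
      · have h1 : Submodule.span ℂ {x} ≤ A := (Submodule.span_singleton_le_iff_mem _ _).2 hx
        have h2 : Submodule.span ℂ {x'} ≤ A :=
          (Submodule.span_singleton_le_iff_mem _ _).2 (ht hx)
        rwa [sup_eq_right.2 h1, ← sup_assoc, sup_eq_left.2 h2]
      · have h1 := finrank_lt_finrank_sup_span_singleton hx
        have h2 := finrank_sup_span_singleton_le (A ⊔ A') x
        have h3 := finrank_sup_span_singleton_le (A ⊔ A' ⊔ Submodule.span ℂ {x}) x'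
        have e3 : Submodule.span ℂ {x} ⊔ A ⊔ (Submodule.span ℂ {x'} ⊔ A') =
            A ⊔ A' ⊔ Submodule.span ℂ {x} ⊔ Submodule.span ℂ {x'} := by
          ac_rfl
        rw [e3, sup_comm (Submodule.span ℂ {x}) A]
        omega
  have hu : {s : Fin n | (s : ℕ) < n} = Set.univ := by ext s; simp
  have hn := key n le_rfl
  rwa [hu, Set.image_univ, Set.image_univ] at hn

/-- Replacing the vectors `r' t` one at a time by vectors `r t` which are in the span of the
others only when `r' t` is does not decrease the dimension of the span. -/
theorem finrank_span_le_of_replace {n : ℕ} {E : Type*} [AddCommGroup E] [Module ℂ E]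
    [FiniteDimensional ℂ E] (r r' : Fin n → E)
    (h : ∀ t, r t ∈ Submodule.span ℂ ((fun s => if s < t then r s else r' s) '' {s | s ≠ t}) →
      r' t ∈ Submodule.span ℂ ((fun s => if s < t then r s else r' s) '' {s | s ≠ t})) :
    Module.finrank ℂ (Submodule.span ℂ (Set.range r'))
      ≤ Module.finrank ℂ (Submodule.span ℂ (Set.range r)) := by
  let B : ℕ → Fin n → E := fun T s => if (s : ℕ) < T then r s else r' s
  have step : ∀ T, T ≤ n → Module.finrank ℂ (Submodule.span ℂ (Set.range r'))
      ≤ Module.finrank ℂ (Submodule.span ℂ (Set.range (B T))) := by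
    intro T
    induction T with
    | zero =>
      intro _
      have h0 : B 0 = r' := by funext s; simp [B]
      rw [h0]
    | succ T ih =>
      intro hT
      refine (ih (Nat.le_of_succ_le hT)).trans ?_
      let t : Fin n := ⟨T, hT⟩
      have hu : (Set.univ : Set (Fin n)) = insert t {s | s ≠ t} := by
        ext s
        simp [em]
      have hB : B T t = r' t := by simp [B, t]
      have hB' : B (T + 1) t = r t := by simp [B, t]
      have hC : B (T + 1) '' {s | s ≠ t} = B T '' {s | s ≠ t} := by
        refine Set.image_congr fun s hs => ?_
        have hs : (s : ℕ) ≠ T := fun h => hs (Fin.ext h)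
        have : (s : ℕ) < T + 1 ↔ (s : ℕ) < T := by omega
        simp only [B, this]
      have ht : r t ∈ Submodule.span ℂ (B T '' {s | s ≠ t}) →
        r' t ∈ Submodule.span ℂ (B T '' {s | s ≠ t}) := h t
      rw [← Set.image_univ, ← Set.image_univ, hu, Set.image_insert_eq, Set.image_insert_eq, hB,
        hB', hC, Submodule.span_insert, Submodule.span_insert,
        sup_comm, sup_comm (Submodule.span ℂ {r t})]
      by_cases hr : r t ∈ Submodule.span ℂ (B T '' {s | s ≠ t})
      · rw [sup_eq_left.2 ((Submodule.span_singleton_le_iff_mem _ _).2 (ht hr))]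
        exact Submodule.finrank_mono le_sup_left
      · exact (finrank_sup_span_singleton_le _ _).trans
          (finrank_lt_finrank_sup_span_singleton hr)
  have hn : B n = r := by funext s; simp [B]
  have hs := step n le_rfl
  rwa [hn] at hs

/-! ### Vectors indexed by blocks -/

/-- The vectors supported on the block `j`. -/
def blockSubmodule {k : ℕ} (d : Fin k → ℕ) (j : Fin k) :
    Submodule ℂ ((Σ i, Fin (d i)) → ℂ) :=
  LinearMap.range (Function.ExtendByZero.linearMap ℂ (Sigma.mk j))

/-- Setting to zero the entries outside the blocks in `S`. -/
def keepBlocks {k : ℕ} (d : Fin k → ℕ) (S : Finset (Fin k)) :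
    ((Σ i, Fin (d i)) → ℂ) →ₗ[ℂ] ((Σ i, Fin (d i)) → ℂ) where
  toFun x c := if c.1 ∈ S then x c else 0
  map_add' x y := by funext c; by_cases h : c.1 ∈ S <;> simp [h]
  map_smul' a x := by funext c; by_cases h : c.1 ∈ S <;> simp [h]

theorem keepBlocks_apply {k : ℕ} (d : Fin k → ℕ) (S : Finset (Fin k))
    (x : (Σ i, Fin (d i)) → ℂ) (c) : keepBlocks d S x c = if c.1 ∈ S then x c else 0 := rfl

theorem keepBlocks_univ {k : ℕ} (d : Fin k → ℕ) : keepBlocks d Finset.univ = LinearMap.id := by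
  ext; simp [keepBlocks_apply]

theorem injective_extendByZero {α β : Type*} {e : α → β} (he : Function.Injective e) :
    Function.Injective (Function.ExtendByZero.linearMap ℂ e) := by
  intro x y h
  funext a
  have := congrFun h (e a)
  simpa [Function.ExtendByZero.linearMap_apply, he.extend_apply] using this

theorem finrank_blockSubmodule {k : ℕ} (d : Fin k → ℕ) (j : Fin k) :
    Module.finrank ℂ (blockSubmodule d j) = d j := by
  rw [blockSubmodule, LinearMap.finrank_range_of_inj (injective_extendByZero sigma_mk_injective)]
  simp

theorem mem_blockSubmodule {k : ℕ} {d : Fin k → ℕ} {j : Fin k} {x : (Σ i, Fin (d i)) → ℂ} :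
    x ∈ blockSubmodule d j ↔ ∀ c, c.1 ≠ j → x c = 0 := by
  constructor
  · rintro ⟨w, rfl⟩ c hc
    rw [Function.ExtendByZero.linearMap_apply, Function.extend_apply']
    · rfl
    · rintro ⟨b, rfl⟩
      exact hc rfl
  · intro h
    refine ⟨fun b => x ⟨j, b⟩, ?_⟩
    funext ⟨i, b⟩
    rw [Function.ExtendByZero.linearMap_apply]
    by_cases hi : i = j
    · subst hi
      have he : Function.Injective (@Sigma.mk _ (fun i => Fin (d i)) i) := sigma_mk_injective
      exact he.extend_apply _ _ b
    · rw [Function.extend_apply', h _ hi]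
      · rfl
      · rintro ⟨b', hb⟩
        exact hi (congrArg Sigma.fst hb).symm

theorem ker_keepBlocks_erase {k : ℕ} (d : Fin k → ℕ) (j : Fin k) :
    LinearMap.ker (keepBlocks d (Finset.univ.erase j)) = blockSubmodule d j := by
  ext x
  rw [LinearMap.mem_ker, mem_blockSubmodule, funext_iff]
  refine forall_congr' fun c => ?_
  simp [keepBlocks_apply]

/-- A subspace containing the block `j` loses exactly that block when its entries are erased. -/
theorem finrank_map_keepBlocks_eq_erase_add {k : ℕ} {d : Fin k → ℕ} {j : Fin k}
    {S : Finset (Fin k)} (hj : j ∈ S) {R : Submodule ℂ ((Σ i, Fin (d i)) → ℂ)}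
    (hR : blockSubmodule d j ≤ R) :
    Module.finrank ℂ (R.map (keepBlocks d S))
      = Module.finrank ℂ (R.map (keepBlocks d (S.erase j))) + d j := by
  have hcomp : keepBlocks d (S.erase j) =
      (keepBlocks d (Finset.univ.erase j)).comp (keepBlocks d S) := by
    refine LinearMap.ext fun x => funext fun c => ?_
    simp only [LinearMap.comp_apply, keepBlocks_apply, Finset.mem_erase, Finset.mem_univ,
      and_true, ite_and]
  have hle : blockSubmodule d j ≤ R.map (keepBlocks d S) := by
    intro x hx
    refine ⟨x, hR hx, funext fun c => ?_⟩
    rw [keepBlocks_apply]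
    split_ifs with hc
    · rfl
    · exact (mem_blockSubmodule.1 hx c fun h => hc (h ▸ hj)).symm
  rw [← finrank_map_add_finrank_inf_ker (keepBlocks d (Finset.univ.erase j))
    (R.map (keepBlocks d S)), ker_keepBlocks_erase, inf_eq_right.2 hle, finrank_blockSubmodule,
    hcomp, Submodule.map_comp]

/-! ### Received subspaces of a strategy -/

namespace Strategy

variable {k m n : ℕ} {I : Fin k → CSITState}

/-- Row of antenna `a` at time `t` of the precoding matrices of the receivers in `S`, padded with
zeros outside `S`. -/
def txRow (f : Strategy k m n I) (S : Finset (Fin k)) (g : Chan k m n) (t : Fin n)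
    (a : Fin m) : (Σ i, Fin (f.dim i)) → ℂ :=
  fun c => if c.1 ∈ S then f.pre c.1 t g a c.2 else 0

/-- Row at time `t` of the received-signal matrix of receiver `j` for the precoders in `S`. -/
def rxRow (f : Strategy k m n I) (S : Finset (Fin k)) (j : Fin k) (g : Chan k m n)
    (t : Fin n) : (Σ i, Fin (f.dim i)) → ℂ :=
  ∑ a, g j t a • f.txRow S g t a

/-- Row space of the received-signal matrix of receiver `j` for the precoders in `S`. -/
def rxSpan (f : Strategy k m n I) (S : Finset (Fin k)) (j : Fin k) (g : Chan k m n) :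
    Submodule ℂ ((Σ i, Fin (f.dim i)) → ℂ) :=
  Submodule.span ℂ (Set.range (f.rxRow S j g))

theorem measurable_txRow (f : Strategy k m n I) (S : Finset (Fin k)) (t : Fin n) (a : Fin m)
    (c : Σ i, Fin (f.dim i)) : Measurable fun g => f.txRow S g t a c := by
  unfold txRow
  split_ifs
  exacts [f.meas _ _ _ _, measurable_const]

theorem measurable_rxRow (f : Strategy k m n I) (S : Finset (Fin k)) (j : Fin k) (t : Fin n)
    (c : Σ i, Fin (f.dim i)) : Measurable fun g => f.rxRow S j g t c := by
  simp only [rxRow, Finset.sum_apply, Pi.smul_apply, smul_eq_mul]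
  refine Finset.measurable_sum _ fun a _ => Measurable.mul ?_ (f.measurable_txRow S t a c)
  fun_prop

theorem rxRow_apply (f : Strategy k m n I) (S : Finset (Fin k)) (j : Fin k) (g : Chan k m n)
    (t : Fin n) (c : Σ i, Fin (f.dim i)) :
    f.rxRow S j g t c =
      if c.1 ∈ S then ∑ a, g j t a * f.pre c.1 t g a c.2 else 0 := by
  simp only [rxRow, txRow, Finset.sum_apply, Pi.smul_apply, smul_eq_mul]
  split_ifs <;> simp

theorem blockDiag_mul_apply {C : Type*} (x : Fin n → Fin m → ℂ)
    (V : Matrix (Fin n × Fin m) C ℂ) (t : Fin n) (c : C) :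
    (blockDiag x * V) t c = ∑ a, x t a * V (t, a) c := by
  rw [Matrix.mul_apply, Fintype.sum_prod_type, Finset.sum_eq_single t]
  · simp [_root_.blockDiag]
  · intro s _ hs
    simp [_root_.blockDiag, hs]
  · simp

theorem finrank_map_of_injective {E F : Type*} [AddCommGroup E] [Module ℂ E]
    [AddCommGroup F] [Module ℂ F] {φ : E →ₗ[ℂ] F} (hφ : Function.Injective φ)
    (R : Submodule ℂ E) : Module.finrank ℂ (R.map φ) = Module.finrank ℂ R :=
  (Submodule.equivMapOfInjective φ hφ R).finrank_eq.symm

theorem rank_eq_finrank_span_of_extend {C C' : Type*} [Fintype C]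
    {e : C → C'} (he : Function.Injective e) (A : Matrix (Fin n) C ℂ) (r : Fin n → C' → ℂ)
    (h : ∀ t c, r t (e c) = A t c) (h0 : ∀ t c', (∀ c, e c ≠ c') → r t c' = 0) :
    A.rank = Module.finrank ℂ (Submodule.span ℂ (Set.range r)) := by
  have hr : r = Function.ExtendByZero.linearMap ℂ e ∘ A.row := by
    funext t c'
    rw [Function.comp_apply, Function.ExtendByZero.linearMap_apply]
    by_cases hc : ∃ c, e c = c'
    · obtain ⟨c, rfl⟩ := hc
      rw [he.extend_apply, h]
      rfl
    · rw [Function.extend_apply' _ _ _ hc, h0 t c' (not_exists.1 hc)]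
      rfl
  rw [hr, Set.range_comp, ← Submodule.map_span,
    finrank_map_of_injective (injective_extendByZero he), Matrix.rank_eq_finrank_span_row]

theorem rank_recvS (f : Strategy k m n I) (S : Finset (Fin k)) (j : Fin k) (g : Chan k m n) :
    (f.recvS S j g).rank = Module.finrank ℂ (f.rxSpan S j g) := by
  refine rank_eq_finrank_span_of_extend
    (e := fun c : (i : {x // x ∈ S}) × Fin (f.dim i.1) => (⟨c.1.1, c.2⟩ : Σ i, Fin (f.dim i)))
    ?_ _ _ ?_ ?_
  · rintro ⟨⟨i, hi⟩, b⟩ ⟨⟨i', hi'⟩, b'⟩ h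
    obtain rfl : i = i' := congrArg Sigma.fst h
    obtain rfl : b = b' := by simpa using h
    rfl
  · rintro t ⟨⟨i, hi⟩, b⟩
    rw [recvS, blockDiag_mul_apply, rxRow_apply, if_pos hi]
    rfl
  · rintro t ⟨i, b⟩ hc
    rw [rxRow_apply, if_neg]
    exact fun hi => hc ⟨⟨i, hi⟩, b⟩ rfl

theorem rank_recv1 (f : Strategy k m n I) (j : Fin k) (g : Chan k m n) :
    (f.recv1 j g).rank = Module.finrank ℂ (f.rxSpan {j} j g) := by
  have he : Function.Injective (@Sigma.mk _ (fun i => Fin (f.dim i)) j) := sigma_mk_injective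
  refine rank_eq_finrank_span_of_extend he _ _ ?_ ?_
  · intro t b
    rw [recv1, blockDiag_mul_apply, rxRow_apply, if_pos (Finset.mem_singleton_self j)]
    rfl
  · rintro t ⟨i, b⟩ hc
    rw [rxRow_apply, if_neg]
    intro hi
    obtain rfl : i = j := Finset.mem_singleton.1 hi
    exact hc b rfl

theorem rxSpan_eq_map (f : Strategy k m n I) (S : Finset (Fin k)) (j : Fin k)
    (g : Chan k m n) : f.rxSpan S j g = (f.rxSpan Finset.univ j g).map (keepBlocks f.dim S) := by
  rw [rxSpan, rxSpan, Submodule.map_span, ← Set.range_comp]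
  congr 2
  funext t c
  simp [keepBlocks_apply, rxRow_apply]

theorem finrank_rxSpan_le (f : Strategy k m n I) (S : Finset (Fin k)) (j : Fin k)
    (g : Chan k m n) : Module.finrank ℂ (f.rxSpan S j g) ≤ n := by
  have h := finrank_range_le_card (R := ℂ) (f.rxRow S j g)
  rwa [Set.finrank, Fintype.card_fin] at h

/-- Decodability at a channel realization means that the received space of each receiver contains
its own block. -/
theorem decodable_iff (f : Strategy k m n I) (j : Fin k) (g : Chan k m n) :
    ((f.recvS Finset.univ j g).rank - (f.recvS (Finset.univ.erase j) j g).rank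
        = (f.recv1 j g).rank ∧ (f.recv1 j g).rank = f.dim j) ↔
      blockSubmodule f.dim j ≤ f.rxSpan Finset.univ j g := by
  rw [rank_recvS, rank_recvS, rank_recv1]
  constructor
  · rintro ⟨h1, h2⟩
    have h3 := finrank_map_add_finrank_inf_ker (keepBlocks f.dim (Finset.univ.erase j))
      (f.rxSpan Finset.univ j g)
    rw [← rxSpan_eq_map, ker_keepBlocks_erase] at h3
    have h4 := finrank_blockSubmodule f.dim j
    rw [← inf_eq_right]
    refine Submodule.eq_of_le_of_finrank_eq inf_le_right ?_
    omega
  · intro h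
    have h1 := finrank_map_keepBlocks_eq_erase_add (Finset.mem_univ j) h
    have h2 := finrank_map_keepBlocks_eq_erase_add (Finset.mem_singleton_self j) h
    rw [← rxSpan_eq_map, ← rxSpan_eq_map] at h1 h2
    have h3 : Module.finrank ℂ (f.rxSpan (({j} : Finset (Fin k)).erase j) j g) = 0 := by
      have : f.rxSpan (({j} : Finset (Fin k)).erase j) j g = ⊥ := by
        rw [rxSpan, Submodule.span_eq_bot]
        rintro _ ⟨t, rfl⟩
        funext c
        simp [rxRow_apply]
      rw [this, finrank_bot]
    omega

/-! ### Rank inequalities from missing CSIT -/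

theorem txRow_update_of_le (f : Strategy k m n I) {j : Fin k} (hj : I j ≠ CSITState.P)
    {s t : Fin n} (hst : s ≤ t) (S : Finset (Fin k)) (g : Chan k m n) (z : Fin m → ℂ) :
    f.txRow S (Function.update g j (Function.update (g j) t z)) s = f.txRow S g s := by
  funext a c
  rw [txRow, txRow, f.causal c.1 s (Function.update g j (Function.update (g j) t z)) g]
  · intro i hi s' _
    rw [Function.update_of_ne]
    rintro rfl
    exact hj hi
  · intro i _ s' hs'
    by_cases h : i = j
    · subst h
      rw [Function.update_self, Function.update_of_ne]
      exact fun h => absurd hs' (not_lt.2 (h ▸ hst))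
    · rw [Function.update_of_ne h]

theorem txRow_update_of_noCSIT (f : Strategy k m n I) {j : Fin k} (hj : I j = CSITState.N)
    (S : Finset (Fin k)) (g : Chan k m n) (y : Fin n → Fin m → ℂ) (s : Fin n) :
    f.txRow S (Function.update g j y) s = f.txRow S g s := by
  funext a c
  rw [txRow, txRow, f.causal c.1 s (Function.update g j y) g]
  all_goals
    intro i hi s' _
    rw [Function.update_of_ne]
    rintro rfl
    simp [hj] at hi

/-- If receiver `j` does not supply instantaneous CSIT, then adding the signal of any other
receiver to that of `j` at most doubles the rank. -/
theorem ae_finrank_sup_le_two_mul (f : Strategy k m n I) (μ : Measure ℂ)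
    [IsProbabilityMeasure μ] [NullSingletonClass μ] {j : Fin k} (hj : I j ≠ CSITState.P)
    (S : Finset (Fin k)) (i : Fin k) :
    ∀ᵐ g ∂ chanMeasure k m n μ,
      Module.finrank ℂ ↥(f.rxSpan S j g ⊔ f.rxSpan S i g)
        ≤ 2 * Module.finrank ℂ (f.rxSpan S j g) := by
  have h : ∀ t : Fin n, ∀ᵐ g ∂ chanMeasure k m n μ,
      f.rxRow S j g t ∈ Submodule.span ℂ (f.rxRow S j g '' {s | s < t}) →
        ∀ a, f.txRow S g t a ∈ Submodule.span ℂ (f.rxRow S j g '' {s | s < t}) := by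
    intro t
    simp only [Set.image_eq_range]
    refine ae_chan_mem_span_imp μ j t (M := fun g (s : {s | s < t}) => f.rxRow S j g s)
      (v := fun g => f.txRow S g t) (fun s c => f.measurable_rxRow S j s c)
      (fun a c => f.measurable_txRow S t a c) (fun g z => ?_)
      fun g z => f.txRow_update_of_le hj le_rfl S g z
    funext ⟨s, hs⟩
    have hs : s < t := hs
    simp only [rxRow, f.txRow_update_of_le hj hs.le, Function.update_self,
      Function.update_of_ne hs.ne]
  filter_upwards [ae_all_iff.2 h] with g hg
  exact finrank_span_sup_le_two_mul _ _ fun t ht =>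
    Submodule.sum_mem _ fun a _ => Submodule.smul_mem _ _ (hg t ht a)

/-- A receiver supplying no CSIT sees at least the rank that any other receiver sees. -/
theorem ae_finrank_le_of_noCSIT (f : Strategy k m n I) (μ : Measure ℂ)
    [IsProbabilityMeasure μ] [NullSingletonClass μ] {j : Fin k} (hj : I j = CSITState.N)
    (S : Finset (Fin k)) (i : Fin k) :
    ∀ᵐ g ∂ chanMeasure k m n μ,
      Module.finrank ℂ (f.rxSpan S i g) ≤ Module.finrank ℂ (f.rxSpan S j g) := by
  rcases eq_or_ne i j with rfl | hij
  · exact Eventually.of_forall fun _ => le_rfl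
  have h : ∀ t : Fin n, ∀ᵐ g ∂ chanMeasure k m n μ,
      f.rxRow S j g t ∈ Submodule.span ℂ
          ((fun s => if s < t then f.rxRow S j g s else f.rxRow S i g s) '' {s | s ≠ t}) →
        ∀ a, f.txRow S g t a ∈ Submodule.span ℂ
          ((fun s => if s < t then f.rxRow S j g s else f.rxRow S i g s) '' {s | s ≠ t}) := by
    intro t
    simp only [Set.image_eq_range]
    refine ae_chan_mem_span_imp μ j t
      (M := fun g (s : {s | s ≠ t}) =>
        if (s : Fin n) < t then f.rxRow S j g s else f.rxRow S i g s)
      (v := fun g => f.txRow S g t) (fun s c => ?_)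
      (fun a c => f.measurable_txRow S t a c) (fun g z => ?_)
      fun g z => f.txRow_update_of_noCSIT hj S g _ t
    · split_ifs
      exacts [f.measurable_rxRow S j s c, f.measurable_rxRow S i s c]
    · funext ⟨s, hs⟩
      have hs : s ≠ t := hs
      simp only [rxRow, f.txRow_update_of_noCSIT hj, Function.update_self,
        Function.update_of_ne hs, Function.update_of_ne hij]
  filter_upwards [ae_all_iff.2 h] with g hg
  exact finrank_span_le_of_replace _ _ fun t ht =>
    Submodule.sum_mem _ fun a _ => Submodule.smul_mem _ _ (hg t ht a)

end Strategy

/-! ### Outer bound -/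

/-- Iterating the rank doubling inequality over the receivers in `T`, averaged over all orders. -/
theorem card_mul_finrank_ge {k : ℕ} {d : Fin k → ℕ}
    {R : Fin k → Submodule ℂ ((Σ i, Fin (d i)) → ℂ)} (hE : ∀ i, blockSubmodule d i ≤ R i)
    {j : Fin k}
    (h2 : ∀ S i, Module.finrank ℂ ((R j ⊔ R i).map (keepBlocks d S))
      ≤ 2 * Module.finrank ℂ ((R j).map (keepBlocks d S))) (T : Finset (Fin k)) :
    ∀ S, T ⊆ S → (1 - (1 / 2 : ℝ) ^ T.card) * ∑ i ∈ T, (d i : ℝ)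
      ≤ T.card * Module.finrank ℂ ((R j).map (keepBlocks d S)) := by
  induction hT : T.card generalizing T with
  | zero => intro S _; simp
  | succ q ih =>
    intro S hS
    set F : ℝ := ((Module.finrank ℂ ((R j).map (keepBlocks d S)) : ℕ) : ℝ) with hF
    set s : ℝ := ∑ i ∈ T, (d i : ℝ) with hs
    have step : ∀ i ∈ T, (q : ℝ) * d i + (1 - (1 / 2 : ℝ) ^ q) * (s - d i) ≤ q * (2 * F) := by
      intro i hi
      have h3 := ih (T.erase i) (by rw [Finset.card_erase_of_mem hi, hT]; rfl) (S.erase i)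
        (Finset.erase_subset_erase i hS)
      have h4 := finrank_map_keepBlocks_eq_erase_add (hS hi) ((hE i).trans (le_sup_right (a := R j)))
      have h5 : Module.finrank ℂ ((R j).map (keepBlocks d (S.erase i)))
          ≤ Module.finrank ℂ ((R j ⊔ R i).map (keepBlocks d (S.erase i))) :=
        Submodule.finrank_mono (Submodule.map_mono le_sup_left)
      have h6 := h2 S i
      have h7 : (d i : ℝ) + Module.finrank ℂ ((R j).map (keepBlocks d (S.erase i))) ≤ 2 * F := by
        rw [hF]
        exact_mod_cast (by omega : d i + Module.finrank ℂ
          ((R j).map (keepBlocks d (S.erase i))) ≤ 2 * Module.finrank ℂ ((R j).map (keepBlocks d S)))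
      have h8 : ∑ x ∈ T.erase i, (d x : ℝ) = s - d i := by
        rw [hs, ← Finset.add_sum_erase T _ hi]; ring
      rw [h8] at h3
      have h9 := mul_le_mul_of_nonneg_left h7 (Nat.cast_nonneg (α := ℝ) q)
      linarith
    have hsum := Finset.sum_le_sum step
    rw [Finset.sum_add_distrib, ← Finset.mul_sum, ← Finset.mul_sum, Finset.sum_sub_distrib,
      Finset.sum_const, Finset.sum_const, hT, ← hs, nsmul_eq_mul, nsmul_eq_mul] at hsum
    push_cast at hsum ⊢
    rcases Nat.eq_zero_or_pos q with rfl | hq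
    · obtain ⟨i, rfl⟩ := Finset.card_eq_one.1 hT
      have h4 := finrank_map_keepBlocks_eq_erase_add (hS (Finset.mem_singleton_self i))
        ((hE i).trans (le_sup_right (a := R j)))
      have h6 := h2 S i
      have h7 : (d i : ℝ) ≤ 2 * F := by
        rw [hF]
        exact_mod_cast (by omega : d i ≤ 2 * Module.finrank ℂ ((R j).map (keepBlocks d S)))
      have : s = d i := by rw [hs, Finset.sum_singleton]
      norm_num
      linarith
    · have hq' : (0 : ℝ) < q := Nat.cast_pos.2 hq
      have h10 : (q : ℝ) * ((2 - (1 / 2 : ℝ) ^ q) * s) ≤ q * (2 * ((q + 1) * F)) := by linarith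
      have h11 := le_of_mul_le_mul_left h10 hq'
      rw [pow_succ]
      linarith

/-- Peeling off the receivers supplying no CSIT. -/
theorem sum_add_finrank_le {k n : ℕ} {d : Fin k → ℕ}
    {R : Fin k → Submodule ℂ ((Σ i, Fin (d i)) → ℂ)} (hE : ∀ i, blockSubmodule d i ≤ R i)
    (hn : ∀ i, Module.finrank ℂ (R i) ≤ n) (A : Finset (Fin k))
    (hA : ∀ j ∈ A, ∀ S i, Module.finrank ℂ ((R i).map (keepBlocks d S))
      ≤ Module.finrank ℂ ((R j).map (keepBlocks d S))) :
    ∀ j, (∑ i ∈ A, d i) + Module.finrank ℂ ((R j).map (keepBlocks d (Finset.univ \ A))) ≤ n := by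
  induction A using Finset.induction_on with
  | empty =>
    intro j
    rw [Finset.sum_empty, zero_add, Finset.sdiff_empty, keepBlocks_univ, Submodule.map_id]
    exact hn j
  | insert i A hi ih =>
    intro j
    have h1 := ih (fun j hj => hA j (Finset.mem_insert_of_mem hj)) i
    have h2 := finrank_map_keepBlocks_eq_erase_add
      (Finset.mem_sdiff.2 ⟨Finset.mem_univ i, hi⟩) (hE i)
    have h3 := hA i (Finset.mem_insert_self i A) (Finset.univ \ insert i A) j
    rw [← Finset.sdiff_insert] at h2
    rw [Finset.sum_insert hi]
    omega

theorem sum_eq_sum_states {k : ℕ} (I : Fin k → CSITState) (d : Fin k → ℝ) :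
    ∑ i, d i = ∑ i ∈ stateP k I, d i + ∑ i ∈ stateD k I, d i + ∑ i ∈ stateN k I, d i := by
  simp only [stateP, stateD, stateN, Finset.sum_filter, ← Finset.sum_add_distrib]
  refine Finset.sum_congr rfl fun i _ => ?_
  cases I i <;> simp

/-- Combination of the single-receiver bounds into the bound on the total number of symbols. -/
theorem total_le_of_bounds {n p q s w x c : ℝ} (hp : 1 ≤ p) (hq : 0 ≤ q) (hqp : q ≤ p)
    (hn : 0 ≤ n) (hc : c ≤ 1) (hw : 0 ≤ w) (hs : s ≤ p * n) (hq1 : q ≠ 0 → 1 ≤ q)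
    (hN : c * s ≤ p * (n - w)) (hD : q * (c * s) ≤ p * (q * n - q * w - x))
    (h0 : q = 0 → x = 0) : s + x + w ≤ n * (p + p * (1 - c)) := by
  have hp0 : 0 < p := by linarith
  refine le_of_mul_le_mul_left ?_ hp0
  rcases eq_or_ne q 0 with hq0 | hq0
  · have hx := h0 hq0
    subst hx
    have h1 : 0 ≤ (p - c) * (p * n - s) := mul_nonneg (by linarith) (by linarith)
    have h2 : 0 ≤ (p - 1) * (p * (n * (1 - c))) :=
      mul_nonneg (by linarith) (mul_nonneg hp0.le (mul_nonneg hn (by linarith)))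
    nlinarith
  · have h1q := hq1 hq0
    have h1 : 0 ≤ (p - q * c) * (p * n - s) :=
      mul_nonneg (by nlinarith) (by linarith)
    have h2 : 0 ≤ (p - q) * (p * (n * (1 - c))) :=
      mul_nonneg (by linarith) (mul_nonneg hp0.le (mul_nonneg hn (by linarith)))
    have h3 : 0 ≤ (q - 1) * (p * w) := mul_nonneg (by linarith) (mul_nonneg hp0.le hw)
    nlinarith

theorem Strategy.Decodable.sum_dim_le {k m n : ℕ} {I : Fin k → CSITState}
    {μ : Measure ℂ} [IsProbabilityMeasure μ] [NullSingletonClass μ]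
    (hPD : (stateD k I).card ≤ (stateP k I).card) (hP : 1 ≤ (stateP k I).card)
    {f : Strategy k m n I} (hf : f.Decodable μ) :
    ∑ i, (f.dim i : ℝ) ≤
      n * ((stateP k I).card + ((stateP k I).card : ℝ) / 2 ^ (stateP k I).card) := by
  have : IsProbabilityMeasure (chanMeasure k m n μ) := by unfold chanMeasure; infer_instance
  have hE : ∀ᵐ g ∂ chanMeasure k m n μ, ∀ i,
      blockSubmodule f.dim i ≤ f.rxSpan Finset.univ i g := by
    refine ae_all_iff.2 fun i => ?_
    filter_upwards [hf i] with g hg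
    exact (f.decodable_iff i g).1 hg
  have h2 : ∀ᵐ g ∂ chanMeasure k m n μ, ∀ j, I j ≠ CSITState.P → ∀ S i,
      Module.finrank ℂ ↥(f.rxSpan S j g ⊔ f.rxSpan S i g)
        ≤ 2 * Module.finrank ℂ (f.rxSpan S j g) := by
    simp only [ae_all_iff]
    exact fun j hj S i => f.ae_finrank_sup_le_two_mul μ hj S i
  have h3 : ∀ᵐ g ∂ chanMeasure k m n μ, ∀ j, I j = CSITState.N → ∀ S i,
      Module.finrank ℂ (f.rxSpan S i g) ≤ Module.finrank ℂ (f.rxSpan S j g) := by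
    simp only [ae_all_iff]
    exact fun j hj S i => f.ae_finrank_le_of_noCSIT μ hj S i
  obtain ⟨g, hE, h2, h3⟩ := (hE.and (h2.and h3)).exists
  let R : Fin k → Submodule ℂ ((Σ i, Fin (f.dim i)) → ℂ) := fun i => f.rxSpan Finset.univ i g
  have hR : ∀ S i, f.rxSpan S i g = (R i).map (keepBlocks f.dim S) := fun S i =>
    f.rxSpan_eq_map S i g
  have h2 : ∀ j, I j ≠ CSITState.P → ∀ S i,
      Module.finrank ℂ ((R j ⊔ R i).map (keepBlocks f.dim S))
        ≤ 2 * Module.finrank ℂ ((R j).map (keepBlocks f.dim S)) := fun j hj S i => by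
    have h := h2 j hj S i
    rwa [hR, hR, ← Submodule.map_sup] at h
  have h3 : ∀ j, I j = CSITState.N → ∀ S i, Module.finrank ℂ ((R i).map (keepBlocks f.dim S))
      ≤ Module.finrank ℂ ((R j).map (keepBlocks f.dim S)) := fun j hj S i => by
    have h := h3 j hj S i
    rwa [hR, hR] at h
  have hn : ∀ i, Module.finrank ℂ (R i) ≤ n := fun i => f.finrank_rxSpan_le _ i g
  have hdim : ∀ i, (f.dim i : ℝ) ≤ n := fun i => by
    rw [← finrank_blockSubmodule f.dim i]
    exact_mod_cast (Submodule.finrank_mono (hE i)).trans (hn i)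
  have hsub : stateP k I ⊆ Finset.univ \ stateN k I := by
    intro i hi
    simp only [stateP, stateN, Finset.mem_filter, Finset.mem_sdiff, Finset.mem_univ,
      true_and] at hi ⊢
    simp [hi]
  have hchainN := sum_add_finrank_le hE hn (stateN k I) fun j hj =>
    h3 j (Finset.mem_filter.1 hj).2
  have hcastN : ∀ j, (∑ i ∈ stateN k I, (f.dim i : ℝ)) +
      Module.finrank ℂ ((R j).map (keepBlocks f.dim (Finset.univ \ stateN k I))) ≤ n :=
    fun j => by exact_mod_cast hchainN j
  set p := (stateP k I).card with hp
  set c : ℝ := 1 - (1 / 2 : ℝ) ^ p with hc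
  have hc1 : c ≤ 1 := by
    rw [hc]
    have : (0 : ℝ) ≤ (1 / 2) ^ p := by positivity
    linarith
  have hs : ∑ i ∈ stateP k I, (f.dim i : ℝ) ≤ p * n := by
    have := Finset.sum_le_card_nsmul (stateP k I) (fun i => (f.dim i : ℝ)) n fun i _ => hdim i
    rwa [nsmul_eq_mul] at this
  have hw : 0 ≤ ∑ i ∈ stateN k I, (f.dim i : ℝ) := Finset.sum_nonneg fun i _ => Nat.cast_nonneg _
  have hs0 : 0 ≤ ∑ i ∈ stateP k I, (f.dim i : ℝ) :=
    Finset.sum_nonneg fun i _ => Nat.cast_nonneg _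
  have hbound : ∀ j, I j ≠ CSITState.P → c * ∑ i ∈ stateP k I, (f.dim i : ℝ)
      ≤ p * (n - ∑ i ∈ stateN k I, (f.dim i : ℝ)) := by
    intro j hj
    refine (card_mul_finrank_ge hE (h2 j hj) (stateP k I) _ hsub).trans ?_
    refine mul_le_mul_of_nonneg_left ?_ (Nat.cast_nonneg _)
    linarith [hcastN j]
  have hboundD : ∀ j ∈ stateD k I, c * ∑ i ∈ stateP k I, (f.dim i : ℝ)
      ≤ p * (n - ∑ i ∈ stateN k I, (f.dim i : ℝ) - f.dim j) := by
    intro j hj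
    have hjD : I j = CSITState.D := (Finset.mem_filter.1 hj).2
    have hjP : I j ≠ CSITState.P := by simp [hjD]
    have hjN : j ∈ Finset.univ \ stateN k I := by simp [stateN, hjD]
    have hsub' : stateP k I ⊆ (Finset.univ \ stateN k I).erase j := by
      intro i hi
      refine Finset.mem_erase.2 ⟨?_, hsub hi⟩
      rintro rfl
      exact hjP (Finset.mem_filter.1 hi).2
    refine (card_mul_finrank_ge hE (h2 j hjP) (stateP k I) _ hsub').trans ?_
    refine mul_le_mul_of_nonneg_left ?_ (Nat.cast_nonneg _)
    have h4 := hcastN j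
    rw [finrank_map_keepBlocks_eq_erase_add hjN (hE j)] at h4
    push_cast at h4
    linarith
  rw [sum_eq_sum_states I]
  have hpow : ((p : ℝ) + (p : ℝ) / 2 ^ p) = p + p * (1 - c) := by
    rw [hc, one_div, inv_pow]; ring
  rw [hpow]
  refine total_le_of_bounds (q := (stateD k I).card) (by exact_mod_cast hP) (Nat.cast_nonneg _)
    (by exact_mod_cast hPD) (Nat.cast_nonneg _) hc1 hw hs ?_ ?_ ?_ ?_
  · intro h
    exact_mod_cast Nat.one_le_iff_ne_zero.2 (Nat.cast_ne_zero.1 h)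
  · rcases (stateN k I).eq_empty_or_nonempty with h | ⟨j, hj⟩
    · rw [h, Finset.sum_empty, sub_zero]
      exact (mul_le_of_le_one_left hs0 hc1).trans hs
    · exact hbound j (by simp [(Finset.mem_filter.1 hj).2])
  · have := Finset.sum_le_sum hboundD
    rw [Finset.sum_const, ← Finset.mul_sum, Finset.sum_sub_distrib, Finset.sum_const,
      nsmul_eq_mul, nsmul_eq_mul] at this
    linarith
  · intro h
    rw [Finset.card_eq_zero.1 (Nat.cast_eq_zero.1 h), Finset.sum_empty]

/-! ### Zero forcing -/

theorem sum_mul_dite_lt {k m : ℕ} (hkm : k ≤ m) (x : Fin m → ℂ) (F : Fin k → ℂ) :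
    ∑ a, x a * (if h : (a : ℕ) < k then F ⟨a, h⟩ else 0) = ∑ b, x (Fin.castLE hkm b) * F b := by
  refine (Fintype.sum_of_injective (Fin.castLE hkm) (Fin.castLE_injective hkm) _ _ ?_ ?_).symm
  · intro a ha
    rw [dif_neg, mul_zero]
    exact fun h => ha ⟨⟨a, h⟩, rfl⟩
  · intro b
    simp

/-- Channel matrix at time `t` seen through the first `k` antennas, in which the rows of the
receivers not supplying instantaneous CSIT are replaced by those of the identity. -/
def zfMatrix {k m n : ℕ} (hkm : k ≤ m) (I : Fin k → CSITState) (g : Chan k m n) (t : Fin n) :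
    Matrix (Fin k) (Fin k) ℂ :=
  Matrix.of fun i => if I i = CSITState.P then fun a => g i t (Fin.castLE hkm a)
    else Pi.single i 1

theorem zfMatrix_row_of_eq {k m n : ℕ} (hkm : k ≤ m) {I : Fin k → CSITState} (g : Chan k m n)
    (t : Fin n) {i : Fin k} (hi : I i = CSITState.P) :
    (zfMatrix hkm I g t).row i = fun a => g i t (Fin.castLE hkm a) :=
  if_pos hi

theorem zfMatrix_row_of_ne {k m n : ℕ} (hkm : k ≤ m) {I : Fin k → CSITState} (g : Chan k m n)
    (t : Fin n) {i : Fin k} (hi : I i ≠ CSITState.P) :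
    (zfMatrix hkm I g t).row i = Pi.single i 1 :=
  if_neg hi

theorem continuous_zfMatrix {k m n : ℕ} (hkm : k ≤ m) (I : Fin k → CSITState) (t : Fin n) :
    Continuous fun g : Chan k m n => zfMatrix hkm I g t := by
  refine continuous_matrix fun i a => ?_
  unfold zfMatrix
  by_cases h : I i = CSITState.P
  · simp only [Matrix.of_apply, if_pos h]
    fun_prop
  · simp only [Matrix.of_apply, if_neg h]
    exact continuous_const

theorem ae_linearIndepOn_zfMatrix {k m n : ℕ} (hkm : k ≤ m) (I : Fin k → CSITState)
    (μ : Measure ℂ) [IsProbabilityMeasure μ] [NullSingletonClass μ] (t : Fin n)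
    (T : Finset (Fin k)) :
    ∀ᵐ g ∂ chanMeasure k m n μ,
      LinearIndepOn ℂ (zfMatrix hkm I g t).row {i | I i ≠ CSITState.P ∨ i ∈ T} := by
  induction T using Finset.induction_on with
  | empty =>
    refine Eventually.of_forall fun g => ?_
    refine ((Pi.basisFun ℂ (Fin k)).linearIndependent.linearIndepOn _).congr fun i hi => ?_
    have hi : I i ≠ CSITState.P := by simpa using hi
    rw [Pi.basisFun_apply, zfMatrix_row_of_ne hkm g t hi]
  | insert j T hj ih =>
    set U : Set (Fin k) := {i | I i ≠ CSITState.P ∨ i ∈ T} with hU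
    have hins : {i | I i ≠ CSITState.P ∨ i ∈ insert j T} = insert j U := by
      ext i
      simp only [hU, Set.mem_ofPred_eq, Set.mem_insert_iff, Finset.mem_insert]
      tauto
    rw [hins]
    by_cases hjP : I j = CSITState.P
    swap
    · have hjU : j ∈ U := Or.inl hjP
      rwa [Set.insert_eq_of_mem hjU]
    have hjU : j ∉ U := by
      simp [hU, hjP, hj]
    have hgen := ae_chan_mem_span_imp μ j t
      (M := fun (g : Chan k m n) (i : U) => (zfMatrix hkm I g t).row i)
      (v := fun _ (a : Fin m) =>
        if h : (a : ℕ) < k then (Pi.single (⟨a, h⟩ : Fin k) 1 : Fin k → ℂ) else 0)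
      (fun i c => ((continuous_zfMatrix hkm I t).matrix_elem i.1 c).measurable)
      (fun a c => measurable_const)
      (fun g z => by
        funext ⟨i, hi⟩
        have hij : i ≠ j := fun h => hjU (h ▸ hi)
        dsimp only
        by_cases hiP : I i = CSITState.P
        · rw [zfMatrix_row_of_eq hkm _ t hiP, zfMatrix_row_of_eq hkm _ t hiP,
            Function.update_of_ne hij]
        · rw [zfMatrix_row_of_ne hkm _ t hiP, zfMatrix_row_of_ne hkm _ t hiP])
      (fun g z => rfl)
    filter_upwards [ih, hgen] with g hg hspan
    refine hg.insert fun hmem => ?_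
    rw [Set.image_eq_range] at hmem
    have hrow : ∑ a, g j t a • (if h : (a : ℕ) < k then
        (Pi.single (⟨a, h⟩ : Fin k) 1 : Fin k → ℂ) else 0) = (zfMatrix hkm I g t).row j := by
      funext b
      have h1 := sum_mul_dite_lt hkm (g j t) fun a => (Pi.single a 1 : Fin k → ℂ) b
      have h2 : (zfMatrix hkm I g t).row j b = g j t (Fin.castLE hkm b) := by
        rw [zfMatrix_row_of_eq hkm g t hjP]
      rw [h2, Finset.sum_apply]
      refine (Finset.sum_congr rfl fun a _ => ?_).trans (h1.trans ?_)
      · split_ifs <;> simp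
      · simp [Pi.single_apply]
    rw [← hrow] at hmem
    have hall := hspan hmem
    have htop : Submodule.span ℂ (Set.range fun i : U => (zfMatrix hkm I g t).row i) = ⊤ := by
      rw [eq_top_iff, ← (Pi.basisFun ℂ (Fin k)).span_eq, Submodule.span_le]
      rintro _ ⟨a, rfl⟩
      have := hall (Fin.castLE hkm a)
      simpa using this
    have hcard := finrank_range_le_card (R := ℂ) fun i : U => (zfMatrix hkm I g t).row i
    rw [Set.finrank, htop, finrank_top, Module.finrank_fin_fun] at hcard
    have hlt : Fintype.card U < Fintype.card (Fin k) := Fintype.card_subtype_lt hjU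
    rw [Fintype.card_fin] at hlt
    exact absurd hcard (not_le.2 hlt)

theorem ae_det_zfMatrix_ne_zero {k m n : ℕ} (hkm : k ≤ m) (I : Fin k → CSITState)
    (μ : Measure ℂ) [IsProbabilityMeasure μ] [NullSingletonClass μ] :
    ∀ᵐ g ∂ chanMeasure k m n μ, ∀ t, (zfMatrix hkm I g t).det ≠ 0 := by
  refine ae_all_iff.2 fun t => ?_
  filter_upwards [ae_linearIndepOn_zfMatrix hkm I μ t Finset.univ] with g hg
  have hu : {i | I i ≠ CSITState.P ∨ i ∈ (Finset.univ : Finset (Fin k))} = Set.univ := by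
    ext i; simp
  rw [hu, linearIndepOn_univ_iff, Matrix.linearIndependent_rows_iff_isUnit,
    Matrix.isUnit_iff_isUnit_det] at hg
  exact hg.ne_zero

/-- Zero forcing: at time `t`, every receiver supplying instantaneous CSIT is sent a new symbol,
along a direction that is nulled at all the other such receivers. -/
def zfStrategy {k m : ℕ} (n : ℕ) (hkm : k ≤ m) (I : Fin k → CSITState) : Strategy k m n I where
  dim j := if I j = CSITState.P then n else 0
  pre j t g := Matrix.of fun a c =>
    if h : (a : ℕ) < k then if (c : ℕ) = t then (zfMatrix hkm I g t).adjugate ⟨a, h⟩ j else 0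
    else 0
  meas j t a c := by
    simp only [Matrix.of_apply]
    by_cases h : (a : ℕ) < k <;> by_cases hc : (c : ℕ) = t <;> simp only [h, hc, dite_true,
      dite_false, if_true, if_false, measurable_const]
    exact ((continuous_zfMatrix hkm I t).matrix_adjugate.matrix_elem _ _).measurable
  causal j t g g' hP _ := by
    have h : zfMatrix hkm I g t = zfMatrix hkm I g' t := by
      ext i a
      simp only [zfMatrix, Matrix.of_apply]
      split_ifs with hi
      · rw [hP i hi t le_rfl]
      · rfl
    rw [h]

theorem zfStrategy_decodable {k m : ℕ} (n : ℕ) (hkm : k ≤ m) (I : Fin k → CSITState)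
    (μ : Measure ℂ) [IsProbabilityMeasure μ] [NullSingletonClass μ] :
    (zfStrategy n hkm I).Decodable μ := by
  intro j
  filter_upwards [ae_det_zfMatrix_ne_zero hkm I μ] with g hg
  rw [Strategy.decodable_iff]
  intro x hx
  rw [mem_blockSubmodule] at hx
  rw [pi_eq_sum_univ' x]
  refine Submodule.sum_mem _ fun c _ => ?_
  by_cases hc : c.1 = j
  swap
  · rw [hx c hc, zero_smul]
    exact Submodule.zero_mem _
  refine Submodule.smul_mem _ _ ?_
  obtain ⟨i, b⟩ := c
  obtain rfl : i = j := hc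
  have hb : (b : ℕ) < if I i = CSITState.P then n else 0 := b.2
  split_ifs at hb with hi
  · let t : Fin n := ⟨b, hb⟩
    have hrow : (zfStrategy n hkm I).rxRow Finset.univ i g t =
        (zfMatrix hkm I g t).det • fun c => if (⟨i, b⟩ : Σ i, Fin _) = c then (1 : ℂ) else 0 := by
      funext ⟨i', b'⟩
      rw [Strategy.rxRow_apply, if_pos (Finset.mem_univ _)]
      refine (sum_mul_dite_lt hkm (g i t) fun a =>
        if (b' : ℕ) = t then (zfMatrix hkm I g t).adjugate a i' else 0).trans ?_
      have hmul : ∑ a, g i t (Fin.castLE hkm a) * (zfMatrix hkm I g t).adjugate a i'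
          = (zfMatrix hkm I g t).det * (1 : Matrix (Fin k) (Fin k) ℂ) i i' := by
        rw [← smul_eq_mul, ← Matrix.smul_apply, ← Matrix.mul_adjugate, Matrix.mul_apply]
        simp only [zfMatrix, Matrix.of_apply, if_pos hi]
      simp only [Pi.smul_apply, smul_eq_mul]
      by_cases hb' : (b' : ℕ) = t
      · simp only [if_pos hb', hmul]
        congr 1
        rw [Matrix.one_apply]
        refine if_congr ⟨?_, fun h => congrArg Sigma.fst h⟩ rfl rfl
        rintro rfl
        have : b = b' := Fin.ext hb'.symm
        rw [this]
      · simp only [if_neg hb', mul_zero, Finset.sum_const_zero]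
        rw [if_neg, mul_zero]
        intro h
        obtain rfl : i = i' := congrArg Sigma.fst h
        obtain rfl : b = b' := by simpa using h
        exact hb' rfl
    have hmem : (zfStrategy n hkm I).rxRow Finset.univ i g t ∈
        (zfStrategy n hkm I).rxSpan Finset.univ i g := Submodule.subset_span ⟨t, rfl⟩
    have hsingle : (fun c => if (⟨i, b⟩ : Σ i, Fin ((zfStrategy n hkm I).dim i)) = c
        then (1 : ℂ) else 0) = Pi.single ⟨i, b⟩ 1 := by
      funext c
      simp only [Pi.single_apply, eq_comm]
    rw [hrow, hsingle] at hmem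
    exact (Submodule.smul_mem_iff _ (hg t)).1 hmem
  · exact absurd hb (Nat.not_lt_zero _)

theorem linAchievable_zeroForcing {k m : ℕ} (hkm : k ≤ m) (I : Fin k → CSITState)
    (μ : Measure ℂ) [IsProbabilityMeasure μ] [NullSingletonClass μ] :
    LinAchievable k m I μ fun j => if I j = CSITState.P then 1 else 0 := by
  refine ⟨fun j => ?_, fun n => zfStrategy n hkm I, fun n => zfStrategy_decodable n hkm I μ,
    fun j => ?_⟩
  · dsimp only
    split_ifs <;> norm_num
  · refine tendsto_const_nhds.congr' ?_
    filter_upwards [eventually_ge_atTop 1] with n hn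
    have hn' : (n : ℝ) ≠ 0 := Nat.cast_ne_zero.2 (by omega)
    simp only [zfStrategy]
    split_ifs
    · rw [div_self hn']
    · simp

/-! ### The region -/

theorem sum_le_of_mem_LDoFRegion {k m : ℕ} {I : Fin k → CSITState} {μ : Measure ℂ}
    [IsProbabilityMeasure μ] [NullSingletonClass μ]
    (hPD : (stateD k I).card ≤ (stateP k I).card) (hP : 1 ≤ (stateP k I).card)
    {d : Fin k → ℝ} (hd : d ∈ LDoFRegion k m I μ) :
    ∑ j, d j ≤ (stateP k I).card + ((stateP k I).card : ℝ) / 2 ^ (stateP k I).card := by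
  have hclosed : IsClosed {d : Fin k → ℝ | ∑ j, d j ≤
      (stateP k I).card + ((stateP k I).card : ℝ) / 2 ^ (stateP k I).card} :=
    isClosed_le (by fun_prop) continuous_const
  refine closure_minimal ?_ hclosed hd
  rintro d ⟨-, F, hF, hlim⟩
  refine le_of_tendsto (tendsto_finsetSum _ fun j _ => hlim j) ?_
  filter_upwards [eventually_ge_atTop 1] with n hn
  have hn' : (0 : ℝ) < n := Nat.cast_pos.2 hn
  rw [← Finset.sum_div, div_le_iff₀' hn']
  exact (hF n).sum_dim_le hPD hP

/-- **Proposition 1.** If at least as many receivers supply instantaneous CSIT as supply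
delayed CSIT (and at least one supplies instantaneous CSIT), then
`|𝒫| ≤ LDoF_sum ≤ |𝒫| + |𝒫|/2^{|𝒫|} ≤ |𝒫| + 1/2`. -/
theorem ldof_sum_approx (k m : ℕ) (hkm : k ≤ m) (I : Fin k → CSITState)
    (μ : Measure ℂ) [IsProbabilityMeasure μ] (hac : μ ≪ (volume : Measure ℂ))
    (hPD : (stateD k I).card ≤ (stateP k I).card) (hP : 1 ≤ (stateP k I).card) :
    ((stateP k I).card : ℝ) ≤ LDoFSum k m I μ ∧
    LDoFSum k m I μ ≤
      ((stateP k I).card : ℝ) + ((stateP k I).card : ℝ) / 2 ^ ((stateP k I).card) ∧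
    ((stateP k I).card : ℝ) + ((stateP k I).card : ℝ) / 2 ^ ((stateP k I).card) ≤
      ((stateP k I).card : ℝ) + 1 / 2 := by
  have : NullSingletonClass μ := ⟨fun x => hac (measure_singleton x)⟩
  have hmem : (fun j => if I j = CSITState.P then (1 : ℝ) else 0) ∈ LDoFRegion k m I μ :=
    subset_closure (linAchievable_zeroForcing hkm I μ)
  have hbound : ∀ s ∈ (fun d : Fin k → ℝ => ∑ j, d j) '' LDoFRegion k m I μ,
      s ≤ (stateP k I).card + ((stateP k I).card : ℝ) / 2 ^ (stateP k I).card := by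
    rintro _ ⟨d, hd, rfl⟩
    exact sum_le_of_mem_LDoFRegion hPD hP hd
  refine ⟨le_csSup ⟨_, hbound⟩ ⟨_, hmem, ?_⟩, csSup_le ⟨_, _, hmem, rfl⟩ hbound, ?_⟩
  · simp [stateP]
  · obtain ⟨q, hq⟩ := Nat.exists_eq_add_of_le' hP
    rw [hq, add_le_add_iff_left, div_le_div_iff₀ (by positivity) two_pos, pow_succ, one_mul]
    have h : ((q + 1 : ℕ) : ℝ) ≤ 2 ^ q := by exact_mod_cast Nat.succ_le_of_lt q.lt_two_pow_self
    linarith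

end
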